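/- The element b² = (y + y⁻¹)² lies in R (indeed b² = (y − y⁻¹)² + 4), b itself does not lie in R, and the division subring of D generated by R together with b is all of D. -/

import Mathlib

/-- `D`, together with the distinguished nonzero elements `x`, `y` satisfying
`x * y = q • (y * x)`, is the `q`-division ring `k_q(x,y)`: the Ore division ring of fractions
of the quantum plane `k_q[x,y]`.  The quantum plane sits inside `D` as the `k`-subalgebra
generated by `x` and `y`; linear independence of the monomials `yⁱxʲ` says that this subalgebra
really is the quantum plane, and `exists_frac` says that `D` is its ring of (left) fractions. -/
structure IsQDivisionRing (k : Type*) [Field k] (D : Type*) [DivisionRing D] [Algebra k D]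
    (q : k) (x y : D) : Prop where
  x_ne_zero : x ≠ 0
  y_ne_zero : y ≠ 0
  rel : x * y = algebraMap k D q * (y * x)
  monomials_linearIndependent :
    LinearIndependent k fun p : ℕ × ℕ => y ^ p.1 * x ^ p.2
  exists_frac : ∀ d : D, ∃ s t : D, s ∈ Algebra.adjoin k ({x, y} : Set D) ∧
    t ∈ Algebra.adjoin k ({x, y} : Set D) ∧ t ≠ 0 ∧ d = t⁻¹ * s

/-- `MemDivisionClosure k s d` says that `d` lies in the division subring of `D`
generated over `k` by the set `s`. -/
inductive MemDivisionClosure (k : Type*) [Field k] {D : Type*} [DivisionRing D] [Algebra k D]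
    (s : Set D) : D → Prop
  | mem {a : D} : a ∈ s → MemDivisionClosure k s a
  | scalar (c : k) : MemDivisionClosure k s (algebraMap k D c)
  | add {a b : D} : MemDivisionClosure k s a → MemDivisionClosure k s b →
      MemDivisionClosure k s (a + b)
  | neg {a : D} : MemDivisionClosure k s a → MemDivisionClosure k s (-a)
  | mul {a b : D} : MemDivisionClosure k s a → MemDivisionClosure k s b →
      MemDivisionClosure k s (a * b)
  | inv {a : D} : MemDivisionClosure k s a → MemDivisionClosure k s a⁻¹

open Polynomial

/-- The pairs `(d, e)` with `d = T.1⁻¹ * S.1` and `e = T.2⁻¹ * S.2` for some `S, T ∈ B`. When both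
projections are injective on `B` this is the graph of the map induced by `B` on fractions. -/
def FractionGraph {R D : Type*} [CommRing R] [DivisionRing D] [Algebra R D]
    (B : Subalgebra R (D × D)) (d e : D) : Prop :=
  ∃ S ∈ B, ∃ T ∈ B, T.1 ≠ 0 ∧ T.1 * d = S.1 ∧ T.2 * e = S.2

namespace FractionGraph

variable {R D : Type*} [CommRing R] [DivisionRing D] [Algebra R D] {B : Subalgebra R (D × D)}

theorem of_mem {p : D × D} (hp : p ∈ B) : FractionGraph B p.1 p.2 :=
  ⟨p, hp, 1, one_mem B, by simp, by simp, by simp⟩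

theorem eq_zero (h0 : ∀ p ∈ B, p.1 = 0 ↔ p.2 = 0) {e : D} (h : FractionGraph B 0 e) : e = 0 := by
  obtain ⟨S, hS, T, hT, hT0, h1, h2⟩ := h
  rw [mul_zero] at h1
  rw [(h0 S hS).1 h1.symm] at h2
  exact (mul_eq_zero.1 h2).resolve_left (mt (h0 T hT).2 hT0)

theorem exists_ore (h0 : ∀ p ∈ B, p.1 = 0 ↔ p.2 = 0)
    (hfrac : ∀ d : D, ∃ S ∈ B, ∃ T ∈ B, T.1 ≠ 0 ∧ T.1 * d = S.1)
    {S T : D × D} (hS : S ∈ B) (hT : T ∈ B) (hT0 : T.1 ≠ 0) :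
    ∃ U ∈ B, ∃ V ∈ B, U.1 ≠ 0 ∧ U * S = V * T := by
  obtain ⟨V, hV, U, hU, hU0, h⟩ := hfrac (S.1 * T.1⁻¹)
  refine ⟨U, hU, V, hV, hU0, ?_⟩
  have h1 : U.1 * S.1 = V.1 * T.1 := by
    rw [← h, mul_assoc, mul_assoc, inv_mul_cancel₀ hT0, mul_one]
  have h2 := (h0 (U * S - V * T) (sub_mem (mul_mem hU hS) (mul_mem hV hT))).1 (by simp [h1])
  exact Prod.ext h1 (sub_eq_zero.1 (by simpa using h2))

theorem neg {d e : D} (h : FractionGraph B d e) : FractionGraph B (-d) (-e) := by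
  obtain ⟨S, hS, T, hT, hT0, h1, h2⟩ := h
  exact ⟨-S, neg_mem hS, T, hT, hT0, by simp [h1], by simp [h2]⟩

theorem add (h0 : ∀ p ∈ B, p.1 = 0 ↔ p.2 = 0)
    (hfrac : ∀ d : D, ∃ S ∈ B, ∃ T ∈ B, T.1 ≠ 0 ∧ T.1 * d = S.1) {d e d' e' : D}
    (h : FractionGraph B d e) (h' : FractionGraph B d' e') :
    FractionGraph B (d + d') (e + e') := by
  obtain ⟨S, hS, T, hT, hT0, h1, h2⟩ := h
  obtain ⟨S', hS', T', hT', hT0', h1', h2'⟩ := h'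
  obtain ⟨U, hU, V, hV, hU0, hUV⟩ := exists_ore h0 hfrac hT hT' hT0'
  refine ⟨U * S + V * S', add_mem (mul_mem hU hS) (mul_mem hV hS'), U * T, mul_mem hU hT,
    mul_ne_zero hU0 hT0, ?_, ?_⟩
  · have := congrArg Prod.fst hUV
    simp only [Prod.fst_mul] at this
    rw [mul_add, Prod.fst_mul, Prod.fst_add, Prod.fst_mul, Prod.fst_mul, ← h1, ← h1', ← mul_assoc,
      ← mul_assoc, this]
  · have := congrArg Prod.snd hUV
    simp only [Prod.snd_mul] at this
    rw [mul_add, Prod.snd_mul, Prod.snd_add, Prod.snd_mul, Prod.snd_mul, ← h2, ← h2', ← mul_assoc,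
      ← mul_assoc, this]

theorem mul (h0 : ∀ p ∈ B, p.1 = 0 ↔ p.2 = 0)
    (hfrac : ∀ d : D, ∃ S ∈ B, ∃ T ∈ B, T.1 ≠ 0 ∧ T.1 * d = S.1) {d e d' e' : D}
    (h : FractionGraph B d e) (h' : FractionGraph B d' e') :
    FractionGraph B (d * d') (e * e') := by
  obtain ⟨S, hS, T, hT, hT0, h1, h2⟩ := h
  obtain ⟨S', hS', T', hT', hT0', h1', h2'⟩ := h'
  obtain ⟨U, hU, V, hV, hU0, hUV⟩ := exists_ore h0 hfrac hS hT' hT0'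
  refine ⟨V * S', mul_mem hV hS', U * T, mul_mem hU hT, mul_ne_zero hU0 hT0, ?_, ?_⟩
  · have := congrArg Prod.fst hUV
    simp only [Prod.fst_mul] at this
    rw [Prod.fst_mul, Prod.fst_mul, ← h1', ← mul_assoc, mul_assoc U.1, h1, this, mul_assoc]
  · have := congrArg Prod.snd hUV
    simp only [Prod.snd_mul] at this
    rw [Prod.snd_mul, Prod.snd_mul, ← h2', ← mul_assoc, mul_assoc U.2, h2, this, mul_assoc]

theorem inv (h0 : ∀ p ∈ B, p.1 = 0 ↔ p.2 = 0) {d e : D} (h : FractionGraph B d e) :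
    FractionGraph B d⁻¹ e⁻¹ := by
  by_cases hd : d = 0
  · subst hd
    rw [eq_zero h0 h]
    simpa using of_mem (zero_mem B)
  · obtain ⟨S, hS, T, hT, hT0, h1, h2⟩ := h
    have hS0 : S.1 ≠ 0 := h1 ▸ mul_ne_zero hT0 hd
    have he : e ≠ 0 := by
      rintro rfl
      exact hS0 ((h0 S hS).2 (by simpa using h2.symm))
    exact ⟨T, hT, S, hS, hS0, by rw [← h1, mul_inv_cancel_right₀ hd],
      by rw [← h2, mul_inv_cancel_right₀ he]⟩

end FractionGraph

theorem FractionGraph.of_memDivisionClosure {k D : Type*} [Field k] [DivisionRing D] [Algebra k D]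
    {B : Subalgebra k (D × D)} (h0 : ∀ p ∈ B, p.1 = 0 ↔ p.2 = 0)
    (hfrac : ∀ d : D, ∃ S ∈ B, ∃ T ∈ B, T.1 ≠ 0 ∧ T.1 * d = S.1) {s : Set D}
    (hs : ∀ d ∈ s, FractionGraph B d d) {d : D} (hd : MemDivisionClosure k s d) :
    FractionGraph B d d := by
  induction hd with
  | mem h => exact hs _ h
  | scalar c => exact of_mem (B.algebraMap_mem c)
  | add _ _ h h' => exact h.add h0 hfrac h'
  | neg _ h => exact h.neg
  | mul _ _ h h' => exact h.mul h0 hfrac h'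
  | inv _ h => exact h.inv h0

/-- If `ξη = qηξ`, the algebra generated by `ξ` and `η` is spanned by the monomials `ηⁱξʲ`. -/
theorem adjoin_pair_le_span_of_mul_eq_smul {k A : Type*} [CommRing k] [Ring A] [Algebra k A] {q : k}
    {ξ η : A} (h : ξ * η = q • (η * ξ)) {z : A} (hz : z ∈ Algebra.adjoin k {ξ, η}) :
    z ∈ Submodule.span k (Set.range fun p : ℕ × ℕ => η ^ p.1 * ξ ^ p.2) := by
  set N := Submodule.span k (Set.range fun p : ℕ × ℕ => η ^ p.1 * ξ ^ p.2)
  have hmem (i j : ℕ) : η ^ i * ξ ^ j ∈ N := Submodule.subset_span ⟨(i, j), rfl⟩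
  have hcomm (i j : ℕ) : ξ ^ j * η ^ i = q ^ (i * j) • (η ^ i * ξ ^ j) := by
    have h1 (i : ℕ) : ξ * η ^ i = q ^ i • (η ^ i * ξ) := by
      induction i with
      | zero => simp
      | succ i ih =>
        rw [pow_succ, ← mul_assoc, ih, smul_mul_assoc, mul_assoc, h, mul_smul_comm, smul_smul,
          ← pow_succ, mul_assoc]
    induction j with
    | zero => simp
    | succ j ih =>
      rw [pow_succ', mul_assoc, ih, mul_smul_comm, ← mul_assoc, h1, smul_mul_assoc, smul_smul,
        mul_assoc, ← pow_add, Nat.mul_succ]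
  have hmul (u v : A) (hu : u ∈ N) (hv : v ∈ N) : u * v ∈ N := by
    have := Submodule.mul_mem_mul hu hv
    rw [Submodule.span_mul_span] at this
    refine Submodule.span_le.2 ?_ this
    rintro _ ⟨_, ⟨⟨i, j⟩, rfl⟩, _, ⟨⟨i', j'⟩, rfl⟩, rfl⟩
    have hprod : η ^ i * ξ ^ j * (η ^ i' * ξ ^ j') = q ^ (i' * j) • (η ^ (i + i') * ξ ^ (j + j')) := by
      rw [mul_assoc, ← mul_assoc (ξ ^ j), hcomm, smul_mul_assoc, mul_smul_comm, pow_add, pow_add]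
      simp only [mul_assoc]
    simpa only [SetLike.mem_coe, hprod] using N.smul_mem _ (hmem _ _)
  have hle : Algebra.adjoin k {ξ, η} ≤ N.toSubalgebra (by simpa using hmem 0 0) hmul := by
    refine Algebra.adjoin_le ?_
    rintro _ (rfl | rfl)
    · simpa using hmem 0 1
    · simpa using hmem 1 0
  exact hle hz

/-- If `x`, `y` and `x'`, `y'` both `q`-commute and have linearly independent monomials, both
projections are injective on the algebra generated by `(x, x')` and `(y, y')`. -/
theorem fst_eq_zero_iff_snd_eq_zero_of_mem_adjoin {k A A' : Type*} [CommRing k] [Ring A]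
    [Algebra k A] [Ring A'] [Algebra k A'] {q : k} {x y : A} {x' y' : A'}
    (h : x * y = q • (y * x)) (h' : x' * y' = q • (y' * x'))
    (hli : LinearIndependent k fun p : ℕ × ℕ => y ^ p.1 * x ^ p.2)
    (hli' : LinearIndependent k fun p : ℕ × ℕ => y' ^ p.1 * x' ^ p.2) {z : A × A'}
    (hz : z ∈ Algebra.adjoin k {(x, x'), (y, y')}) : z.1 = 0 ↔ z.2 = 0 := by
  obtain ⟨c, rfl⟩ := Finsupp.mem_span_range_iff_exists_finsupp.1
    (adjoin_pair_le_span_of_mul_eq_smul (q := q) (Prod.ext h h') hz)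
  have h1 : (c.sum fun i a => a • ((y, y') ^ i.1 * (x, x') ^ i.2)).1 =
      Finsupp.linearCombination k (fun p : ℕ × ℕ => y ^ p.1 * x ^ p.2) c := by
    simp [Finsupp.linearCombination_apply, Finsupp.sum, Prod.fst_sum]
  have h2 : (c.sum fun i a => a • ((y, y') ^ i.1 * (x, x') ^ i.2)).2 =
      Finsupp.linearCombination k (fun p : ℕ × ℕ => y' ^ p.1 * x' ^ p.2) c := by
    simp [Finsupp.linearCombination_apply, Finsupp.sum, Prod.snd_sum]
  rw [h1, h2]
  constructor <;> intro h0
  · rw [linearIndependent_iff.1 hli c h0, map_zero]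
  · rw [linearIndependent_iff.1 hli' c h0, map_zero]

/-- The fraction field of `k[X]` embeds in `D` along evaluation at a transcendental element. -/
theorem exists_fractionRing_hom {k D : Type*} [Field k] [DivisionRing D] [Algebra k D] {y : D}
    (hy : Transcendental k y) :
    ∃ ι : FractionRing k[X] →+* D, ∀ p : k[X], ι (algebraMap k[X] _ p) = aeval y p := by
  have hu (p : nonZeroDivisors k[X]) :
      IsUnit (((aeval y : k[X] →ₐ[k] D) : k[X] →* D).comp (nonZeroDivisors k[X]).subtype p) := by
    refine IsUnit.mk0 _ fun h => nonZeroDivisors.coe_ne_zero p ?_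
    exact transcendental_iff.1 hy _ h
  exact ⟨OreLocalization.universalHom (aeval y : k[X] →ₐ[k] D).toRingHom (IsUnit.liftRight _ hu)
    fun p => (IsUnit.coe_liftRight _ hu p).symm, fun p => OreLocalization.universalHom_commutes ..⟩

section Localization

variable {k D : Type*} [Field k] [DivisionRing D] [Algebra k D] {x y : D}
  {ι : FractionRing k[X] →+* D}

theorem transcendental_of_linearIndependent_monomials
    (hli : LinearIndependent k fun p : ℕ × ℕ => y ^ p.1 * x ^ p.2) : Transcendental k y := by
  have h : LinearIndependent k fun i : ℕ => y ^ i := by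
    simpa [Function.comp_def] using
      hli.comp (fun i : ℕ => (i, 0)) (fun i j h => congrArg Prod.fst h)
  refine transcendental_iff.2 fun p hp => ?_
  rw [aeval_eq_sum_range] at hp
  ext i
  by_cases hi : i ∈ Finset.range (p.natDegree + 1)
  · simpa using linearIndependent_iff'.1 h _ _ hp i hi
  · exact coeff_eq_zero_of_natDegree_lt (by simpa [Nat.lt_succ_iff] using hi)

theorem linearIndependent_pow_of_transcendental {A : Type*} [Ring A] [Algebra k A] {z : A}
    (hz : Transcendental k z) : LinearIndependent k fun i : ℕ => z ^ i := by
  have := (Polynomial.basisMonomials k).linearIndependent.map' (aeval z).toLinearMap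
    (LinearMap.ker_eq_bot.2 (transcendental_iff_injective.1 hz))
  simpa [Function.comp_def, aeval_monomial] using this

theorem coeff_eq_zero_of_sum_mul_pow_eq_zero
    (hli : LinearIndependent k fun p : ℕ × ℕ => y ^ p.1 * x ^ p.2)
    (hι : ∀ p : k[X], ι (algebraMap k[X] _ p) = aeval y p) (s : Finset ℕ)
    (g : ℕ → FractionRing k[X]) (hg : ∑ j ∈ s, ι (g j) * x ^ j = 0) : ∀ j ∈ s, g j = 0 := by
  obtain ⟨b, hb⟩ := IsLocalization.exist_integer_multiples (nonZeroDivisors k[X]) s g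
  choose! P hP using hb
  have hsum : ∑ j ∈ s, aeval y (P j) * x ^ j = 0 := by
    have := congrArg (ι (algebraMap k[X] _ (b : k[X])) * ·) hg
    simp only [mul_zero, Finset.mul_sum, ← mul_assoc, ← map_mul] at this
    rw [← this]
    refine Finset.sum_congr rfl fun j hj => ?_
    rw [← hι, hP j hj, Algebra.smul_def]
  set N := (s.sup fun j => (P j).natDegree) + 1 with hN
  have hlt (j : ℕ) (hj : j ∈ s) : (P j).natDegree < N :=
    Nat.lt_succ_iff.2 (Finset.le_sup (f := fun j => (P j).natDegree) hj)
  have hsum' : ∑ p ∈ Finset.range N ×ˢ s, (P p.2).coeff p.1 • (y ^ p.1 * x ^ p.2) = 0 := by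
    rw [← hsum, Finset.sum_product_right]
    refine Finset.sum_congr rfl fun j hj => ?_
    rw [aeval_eq_sum_range' (hlt j hj), Finset.sum_mul]
    simp only [smul_mul_assoc]
  intro j hj
  have hPj : P j = 0 := by
    ext i
    by_cases hi : i < N
    · exact linearIndependent_iff'.1 hli _ _ hsum' (i, j) (by simp [hi, hj])
    · exact coeff_eq_zero_of_natDegree_lt ((hlt j hj).trans_le (not_lt.1 hi))
  have := hP j hj
  rw [hPj, map_zero, eq_comm, Algebra.smul_def, mul_eq_zero] at this
  exact this.resolve_left (by simp)

theorem exists_semiconjBy_of_semiconjBy {u : D} {c : k}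
    (hy : SemiconjBy u y (c • y))
    (hι : ∀ p : k[X], ι (algebraMap k[X] _ p) = aeval y p) (f : FractionRing k[X]) :
    ∃ f', SemiconjBy u (ι f) (ι f') := by
  have hpoly (p : k[X]) : SemiconjBy u (aeval y p) (aeval y (p.comp (C c * X))) := by
    rw [aeval_comp, map_mul, aeval_C, aeval_X, ← Algebra.smul_def]
    induction p using Polynomial.induction_on' with
    | add p r hp hr => simpa using hp.add_right hr
    | monomial n a =>
      rw [aeval_monomial, aeval_monomial]
      exact SemiconjBy.mul_right (Algebra.commutes a u).symm (hy.pow_right n)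
  obtain ⟨p, r, -, rfl⟩ := IsFractionRing.div_surjective k[X] f
  refine ⟨algebraMap k[X] _ (p.comp (C c * X)) / algebraMap k[X] _ (r.comp (C c * X)), ?_⟩
  rw [map_div₀, map_div₀, hι, hι, hι, hι, div_eq_mul_inv, div_eq_mul_inv]
  exact (hpoly p).mul_right (hpoly r).inv_right₀

/-- The monomials in `ι v` and `ι f * x⁻¹`, with `v` transcendental, are linearly independent. -/
theorem linearIndependent_monomials_inv
    (hli : LinearIndependent k fun p : ℕ × ℕ => y ^ p.1 * x ^ p.2) (hx : x ≠ 0)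
    (hι : ∀ p : k[X], ι (algebraMap k[X] _ p) = aeval y p)
    (hconj : ∀ f, ∃ f', SemiconjBy x⁻¹ (ι f) (ι f'))
    {v f : FractionRing k[X]} (hv : Transcendental k v) (hf : f ≠ 0) :
    LinearIndependent k fun p : ℕ × ℕ => ι v ^ p.1 * (ι f * x⁻¹) ^ p.2 := by
  have hpow (j : ℕ) : ∃ u : (FractionRing k[X])ˣ, (ι f * x⁻¹) ^ j = ι u * x⁻¹ ^ j := by
    induction j with
    | zero => exact ⟨1, by simp⟩
    | succ j ih =>
      obtain ⟨u, hu⟩ := ih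
      obtain ⟨u', hu'⟩ := hconj u
      have hu0 : u' ≠ 0 := by
        rintro rfl
        have := hu'.eq
        rw [map_zero, zero_mul] at this
        simp [hx] at this
      refine ⟨Units.mk0 (f * u') (mul_ne_zero hf hu0), ?_⟩
      rw [pow_succ', hu, mul_assoc, ← mul_assoc x⁻¹, hu'.eq, Units.val_mk0, map_mul, pow_succ']
      simp only [mul_assoc]
  choose u hu using hpow
  let _ : Module (FractionRing k[X]) D := Module.compHom D ι
  have hsmul (a : FractionRing k[X]) (d : D) : a • d = ι a * d := rfl
  have : IsScalarTower k (FractionRing k[X]) D := ⟨fun c a d => by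
    rw [hsmul, hsmul, Algebra.smul_def, IsScalarTower.algebraMap_apply k k[X], map_mul, hι,
      Polynomial.algebraMap_eq, aeval_C, Algebra.smul_def, mul_assoc]⟩
  have hinv : LinearIndependent (FractionRing k[X]) fun j : ℕ => x⁻¹ ^ j := by
    refine linearIndependent_iff'.2 fun s g hg => ?_
    set n := s.sup id
    have hle (j : ℕ) (hj : j ∈ s) : j ≤ n := Finset.le_sup (f := id) hj
    have hinj : Set.InjOn (fun j => n - j) s := fun i hi j hj h => by
      have := hle i hi
      have := hle j hj
      simp only at h
      omega
    have := coeff_eq_zero_of_sum_mul_pow_eq_zero hli hι (s.image fun j => n - j)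
      (fun j => g (n - j)) (by
        rw [Finset.sum_image hinj]
        have := congrArg (· * x ^ n) hg
        simp only [Finset.sum_mul, zero_mul] at this
        rw [← this]
        refine Finset.sum_congr rfl fun j hj => ?_
        rw [hsmul, Nat.sub_sub_self (hle j hj), mul_assoc, inv_pow]
        nth_rw 2 [← Nat.add_sub_cancel' (hle j hj)]
        rw [pow_add, inv_mul_cancel_left₀ (pow_ne_zero j hx)])
    intro j hj
    simpa [Nat.sub_sub_self (hle j hj)] using this (n - j) (Finset.mem_image_of_mem _ hj)
  have := linearIndependent_smul (linearIndependent_pow_of_transcendental hv)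
    (hinv.units_smul u)
  convert this using 2 with p
  rw [hu, hsmul, map_pow]
  rfl

end Localization

section QuantumTorus

variable {K D : Type*} [Field K] [DivisionRing D] {ι : K →+* D} {x w : D}

theorem add_mul_add_eq_of_semiconjBy {e₁ e₂ e₃ e₄ e₃' e₄' e₃'' e₄'' α β : K}
    (h₃ : SemiconjBy x (ι e₃) (ι e₃')) (h₄ : SemiconjBy x (ι e₄) (ι e₄'))
    (h₃' : SemiconjBy w (ι e₃) (ι e₃'')) (h₄' : SemiconjBy w (ι e₄) (ι e₄''))
    (hα : x * w = ι α) (hβ : w * x = ι β) :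
    (ι e₁ * x + ι e₂ * w) * (ι e₃ * x + ι e₄ * w) =
      ι (e₁ * e₃') * x ^ 2 + ι (e₁ * e₄' * α + e₂ * e₃'' * β) + ι (e₂ * e₄'') * w ^ 2 := by
  have h (u v : D) (e f f' : K) (hf : SemiconjBy u (ι f) (ι f')) :
      ι e * u * (ι f * v) = ι (e * f') * (u * v) := by
    rw [mul_assoc, ← mul_assoc u, hf.eq, map_mul]
    simp only [mul_assoc]
  rw [add_mul, mul_add, mul_add, h _ _ _ _ _ h₃, h _ _ _ _ _ h₄, h _ _ _ _ _ h₃',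
    h _ _ _ _ _ h₄', hα, hβ, ← map_mul, ← map_mul, map_add, pow_two, pow_two]
  simp only [add_assoc]

variable {q t : K}

theorem semiconjBy_map_add_inv (ht : SemiconjBy x (ι t) (ι (q * t))) :
    SemiconjBy x (ι (t + t⁻¹)⁻¹) (ι (q * t + (q * t)⁻¹)⁻¹) := by
  simpa only [map_inv₀, map_add] using (ht.add_right ht.inv_right₀).inv_right₀

theorem mul_sub_mul_eq_of_semiconjBy (hq : q ≠ 0) (ht0 : t ≠ 0) (h₁ : t ^ 2 + 1 ≠ 0)
    (h₂ : q ^ 2 * t ^ 2 + 1 ≠ 0) (h₃ : t ^ 2 + q ^ 2 ≠ 0)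
    (hqc : ∀ d, Commute (ι q) d)
    (hx : SemiconjBy x (ι t) (ι (q * t))) (hw : SemiconjBy w (ι t) (ι (q⁻¹ * t)))
    (hα : x * w = ι ((q * t)⁻¹ - t)) (hβ : w * x = ι (t⁻¹ - q⁻¹ * t)) :
    let h := ι (t + t⁻¹)⁻¹ * (x - w)
    let g := ι (t + t⁻¹)⁻¹ * (ι (q * t) * x + ι (q * t⁻¹) * w)
    (∃ B C : K, g * h = ι ((t + t⁻¹)⁻¹ * (q * t) * (q * t + (q * t)⁻¹)⁻¹) * x ^ 2 + ι B +
      ι C * w ^ 2) ∧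
    ι (t - t⁻¹) * (1 - g * h) = ι q * h ^ 2 - ι (q⁻¹ ^ 2) * g ^ 2 := by
  intro h g
  have hh : h = ι (t + t⁻¹)⁻¹ * x + ι (-(t + t⁻¹)⁻¹) * w := by
    simp only [h, map_neg, mul_sub, neg_mul, sub_eq_add_neg]
  have hg : g = ι ((t + t⁻¹)⁻¹ * (q * t)) * x + ι ((t + t⁻¹)⁻¹ * (q * t⁻¹)) * w := by
    simp only [g, mul_add, map_mul, mul_assoc]
  have hbx := semiconjBy_map_add_inv hx
  have hbw := semiconjBy_map_add_inv hw
  have hqs {z : D} {e e' : K} (he : SemiconjBy z (ι e) (ι e')) :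
      SemiconjBy z (ι (q * e)) (ι (q * e')) := by
    simpa only [map_mul] using SemiconjBy.mul_right (hqc z).symm he
  have hinv {z : D} {e e' : K} (he : SemiconjBy z (ι e) (ι e')) :
      SemiconjBy z (ι e⁻¹) (ι e'⁻¹) := by
    simpa only [map_inv₀] using he.inv_right₀
  have hmul {z : D} {e e' f f' : K} (he : SemiconjBy z (ι e) (ι e'))
      (hf : SemiconjBy z (ι f) (ι f')) : SemiconjBy z (ι (e * f)) (ι (e' * f')) := by
    simpa only [map_mul] using he.mul_right hf
  have hneg {z : D} {e e' : K} (he : SemiconjBy z (ι e) (ι e')) :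
      SemiconjBy z (ι (-e)) (ι (-e')) := by
    simpa only [map_neg] using he.neg_right
  have hhh := add_mul_add_eq_of_semiconjBy (e₁ := (t + t⁻¹)⁻¹) (e₂ := -(t + t⁻¹)⁻¹)
    hbx (hneg hbx) hbw (hneg hbw) hα hβ
  have hgh := add_mul_add_eq_of_semiconjBy (e₁ := (t + t⁻¹)⁻¹ * (q * t))
    (e₂ := (t + t⁻¹)⁻¹ * (q * t⁻¹)) hbx (hneg hbx) hbw (hneg hbw) hα hβ
  have hgg := add_mul_add_eq_of_semiconjBy (e₁ := (t + t⁻¹)⁻¹ * (q * t))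
    (e₂ := (t + t⁻¹)⁻¹ * (q * t⁻¹)) (hmul hbx (hqs hx)) (hmul hbx (hqs (hinv hx)))
    (hmul hbw (hqs hw)) (hmul hbw (hqs (hinv hw))) hα hβ
  rw [← hh] at hhh hgh
  rw [← hg] at hgh hgg
  refine ⟨⟨_, _, hgh⟩, ?_⟩
  rw [hgh, pow_two h, pow_two g, hhh, hgg]
  have key (a b c a₁ b₁ c₁ a₂ b₂ c₂ s r r' : K) (X W : D) (ha : -(s * a) = r * a₁ - r' * a₂)
      (hb : s * (1 - b) = r * b₁ - r' * b₂) (hc : -(s * c) = r * c₁ - r' * c₂) :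
      ι s * (1 - (ι a * X + ι b + ι c * W)) =
        ι r * (ι a₁ * X + ι b₁ + ι c₁ * W) - ι r' * (ι a₂ * X + ι b₂ + ι c₂ * W) := by
    replace ha := congrArg ι ha
    replace hb := congrArg ι hb
    replace hc := congrArg ι hc
    simp only [map_neg, map_mul, map_sub, map_one] at ha hb hc
    calc _ = -(ι s * ι a) * X + ι s * (1 - ι b) + -(ι s * ι c) * W := by noncomm_ring
      _ = _ := by rw [ha, hb, hc]; noncomm_ring
  have hu : (q * t + (q * t)⁻¹)⁻¹ = q * t / (q ^ 2 * t ^ 2 + 1) := by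
    have : q * t + (q * t)⁻¹ = (q ^ 2 * t ^ 2 + 1) / (q * t) := by field_simp
    rw [this, inv_div]
  have hv : (q⁻¹ * t + (q⁻¹ * t)⁻¹)⁻¹ = q * t / (t ^ 2 + q ^ 2) := by
    have : q⁻¹ * t + (q⁻¹ * t)⁻¹ = (t ^ 2 + q ^ 2) / (q * t) := by field_simp
    rw [this, inv_div]
  have hb : (t + t⁻¹)⁻¹ = t / (t ^ 2 + 1) := by
    have : t + t⁻¹ = (t ^ 2 + 1) / t := by field_simp
    rw [this, inv_div]
  apply key
  · rw [hu, hb]; field_simp; ring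
  · rw [hu, hv, hb]
    generalize hU : q ^ 2 * t ^ 2 + 1 = U at h₂ ⊢
    field_simp
    rw [← hU]
    ring
  · rw [hv, hb]; field_simp

end QuantumTorus

theorem MemDivisionClosure.sub {k D : Type*} [Field k] [DivisionRing D] [Algebra k D] {s : Set D}
    {a b : D} (ha : MemDivisionClosure k s a) (hb : MemDivisionClosure k s b) :
    MemDivisionClosure k s (a - b) :=
  sub_eq_add_neg a b ▸ ha.add hb.neg

theorem MemDivisionClosure.natCast {k D : Type*} [Field k] [DivisionRing D] [Algebra k D]
    {s : Set D} (n : ℕ) : MemDivisionClosure k s n := by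
  simpa only [map_natCast] using MemDivisionClosure.scalar (s := s) (n : k)

theorem MemDivisionClosure.mono {k D : Type*} [Field k] [DivisionRing D] [Algebra k D]
    {s t : Set D} (hst : s ⊆ t) {a : D} (ha : MemDivisionClosure k s a) :
    MemDivisionClosure k t a := by
  induction ha with
  | mem h => exact .mem (hst h)
  | scalar c => exact .scalar c
  | add _ _ h h' => exact h.add h'
  | neg _ h => exact h.neg
  | mul _ _ h h' => exact h.mul h'
  | inv _ h => exact h.inv

theorem MemDivisionClosure.of_mem_adjoin {k D : Type*} [Field k] [DivisionRing D] [Algebra k D]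
    {s t : Set D} (hst : ∀ d ∈ t, MemDivisionClosure k s d) {d : D}
    (hd : d ∈ Algebra.adjoin k t) : MemDivisionClosure k s d := by
  induction hd using Algebra.adjoin_induction with
  | mem d h => exact hst d h
  | algebraMap c => exact .scalar c
  | add _ _ _ _ h h' => exact h.add h'
  | mul _ _ _ _ h h' => exact h.mul h'

namespace IsQDivisionRing

variable {k D : Type*} [Field k] [DivisionRing D] [Algebra k D] {q : k} {x y : D}

theorem memDivisionClosure (hD : IsQDivisionRing k D q x y) {s : Set D}
    (hx : MemDivisionClosure k s x) (hy : MemDivisionClosure k s y) (d : D) :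
    MemDivisionClosure k s d := by
  have hxy : ∀ d ∈ ({x, y} : Set D), MemDivisionClosure k s d := by
    rintro _ (rfl | rfl) <;> assumption
  obtain ⟨u, v, hu, hv, -, rfl⟩ := hD.exists_frac d
  exact (MemDivisionClosure.of_mem_adjoin hxy hv).inv.mul (.of_mem_adjoin hxy hu)

theorem transcendental (hD : IsQDivisionRing k D q x y) : Transcendental k y :=
  transcendental_of_linearIndependent_monomials hD.monomials_linearIndependent

theorem semiconjBy_inv (hD : IsQDivisionRing k D q x y) (hq : q ≠ 0) :
    SemiconjBy x⁻¹ y (q⁻¹ • y) := by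
  refine SemiconjBy.inv_symm_left₀ ?_
  rw [SemiconjBy, mul_smul_comm, hD.rel, ← Algebra.smul_def, inv_smul_smul₀ hq]

/-- The element `y - y⁻¹` is a fraction in `h` and `g`. -/
theorem sub_inv_mul_one_sub_eq (hD : IsQDivisionRing k D q x y) (hq : q ≠ 0) :
    let Q : D := algebraMap k D q
    let Λ : D := y⁻¹ - Q⁻¹ * y
    let h : D := (y + y⁻¹)⁻¹ * (x - Λ * x⁻¹)
    let g : D := (y + y⁻¹)⁻¹ * (x * y + Λ * (x⁻¹ * y⁻¹))
    1 - g * h ≠ 0 ∧ (y - y⁻¹) * (1 - g * h) = Q * h ^ 2 - Q⁻¹ ^ 2 * g ^ 2 := by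
  intro Q Λ h g
  obtain ⟨ι, hι⟩ := exists_fractionRing_hom hD.transcendental
  set t : FractionRing k[X] := algebraMap k[X] _ X with ht
  set r : FractionRing k[X] := algebraMap k[X] _ (C q) with hr
  have hιt : ι t = y := by rw [hι, aeval_X]
  have hιr : ι r = Q := by rw [hι, aeval_C]
  have hr0 : r ≠ 0 := by simpa [hr] using hq
  have ht0 : t ≠ 0 := by simp [ht]
  have hne (p : k[X]) (hp : p ≠ 0) : algebraMap k[X] (FractionRing k[X]) p ≠ 0 := by simpa using hp
  have h₁ : t ^ 2 + 1 ≠ 0 := by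
    have := hne (X ^ 2 + 1) fun h => by simpa using congrArg (eval 0) h
    rwa [map_add, map_pow, map_one] at this
  have h₂ : r ^ 2 * t ^ 2 + 1 ≠ 0 := by
    have := hne (C q ^ 2 * X ^ 2 + 1) fun h => by simpa using congrArg (eval 0) h
    rwa [map_add, map_mul, map_pow, map_pow, map_one] at this
  have h₃ : t ^ 2 + r ^ 2 ≠ 0 := by
    have := hne (X ^ 2 + C q ^ 2) fun h => hq (by simpa using congrArg (eval 0) h)
    rwa [map_add, map_pow, map_pow] at this
  have hrc (d : D) : Commute (ι r) d := by
    rw [hιr]; exact Algebra.commutes q d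
  have hx : SemiconjBy x (ι t) (ι (r * t)) := by
    rw [map_mul, hιr, hιt, SemiconjBy, hD.rel, mul_assoc]
  have hxi : SemiconjBy x⁻¹ (ι t) (ι (r⁻¹ * t)) := by
    rw [map_mul, map_inv₀, hιr, hιt]
    simpa only [Algebra.smul_def, map_inv₀] using hD.semiconjBy_inv hq
  set w : D := Λ * x⁻¹
  have hΛ : Λ = ι (t⁻¹ - r⁻¹ * t) := by
    simp only [Λ, map_sub, map_mul, map_inv₀, hιt, hιr]
  have hw : SemiconjBy w (ι t) (ι (r⁻¹ * t)) := by
    refine SemiconjBy.mul_left ?_ hxi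
    rw [hΛ, SemiconjBy, ← map_mul, ← map_mul, mul_comm]
  have hβ : w * x = ι (t⁻¹ - r⁻¹ * t) := by
    rw [← hΛ, inv_mul_cancel_right₀ hD.x_ne_zero]
  have hrs {z : D} {e e' : FractionRing k[X]} (he : SemiconjBy z (ι e) (ι e')) :
      SemiconjBy z (ι (r⁻¹ * e)) (ι (r⁻¹ * e')) := by
    simpa only [map_mul, map_inv₀] using SemiconjBy.mul_right (hrc z).symm.inv_right₀ he
  have hinv {z : D} {e e' : FractionRing k[X]} (he : SemiconjBy z (ι e) (ι e')) :
      SemiconjBy z (ι e⁻¹) (ι e'⁻¹) := by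
    simpa only [map_inv₀] using he.inv_right₀
  have hsub {z : D} {e e' f f' : FractionRing k[X]} (he : SemiconjBy z (ι e) (ι e'))
      (hf : SemiconjBy z (ι f) (ι f')) : SemiconjBy z (ι (e - f)) (ι (e' - f')) := by
    simpa only [map_sub] using he.sub_right hf
  have hα : x * w = ι ((r * t)⁻¹ - t) := by
    have := (hsub (hinv hx) (hrs hx)).eq
    rw [← mul_assoc, hΛ, this, mul_inv_cancel_right₀ hD.x_ne_zero, inv_mul_cancel_left₀ hr0]
  obtain ⟨⟨B, E, hgh⟩, hs⟩ := mul_sub_mul_eq_of_semiconjBy hr0 ht0 h₁ h₂ h₃ hrc hx hw hα hβ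
  have hh : ι (t + t⁻¹)⁻¹ * (x - w) = h := by
    rw [map_inv₀, map_add, map_inv₀, hιt]
  have hg : ι (t + t⁻¹)⁻¹ * (ι (r * t) * x + ι (r * t⁻¹) * w) = g := by
    have h1 := hx.eq
    have h2 := (hinv hw).eq
    rw [mul_inv, inv_inv, map_inv₀, hιt] at h2
    rw [map_inv₀, map_add, map_inv₀, hιt, ← h1, hιt, ← h2]
    simp only [g, w, mul_assoc]
  rw [hh, hg] at hgh hs
  refine ⟨fun h0 => ?_, by
    simpa only [map_sub, map_pow, map_inv₀, hιt, hιr] using hs⟩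
  have hwx : w ^ 2 * x ^ 2 = ι ((r⁻¹ * t)⁻¹ - r⁻¹ * (r⁻¹ * t)) * ι (t⁻¹ - r⁻¹ * t) := by
    have := (hsub (hinv hw) (hrs hw)).eq
    calc w ^ 2 * x ^ 2 = w * (w * x) * x := by simp only [pow_two, mul_assoc]
      _ = _ := by rw [hβ, this, mul_assoc, hβ]
  set F := ((r⁻¹ * t)⁻¹ - r⁻¹ * (r⁻¹ * t)) * (t⁻¹ - r⁻¹ * t)
  set A := (t + t⁻¹)⁻¹ * (r * t) * (r * t + (r * t)⁻¹)⁻¹ with hA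
  have hzero : ι A * x ^ 4 + ι (B - 1) * x ^ 2 + ι (E * F) * x ^ 0 = 0 := by
    have h1 : ι A * x ^ 2 + ι (B - 1) + ι E * w ^ 2 = 0 := by
      rw [map_sub, map_one, ← neg_eq_zero, ← h0, hgh]
      abel
    have h2 := congrArg (· * x ^ 2) h1
    simp only [add_mul, zero_mul, mul_assoc, hwx, ← pow_add, ← map_mul] at h2
    simpa [F] using h2
  have hA0 : A = 0 := by
    refine coeff_eq_zero_of_sum_mul_pow_eq_zero hD.monomials_linearIndependent hι {4, 2, 0}
      (fun j => if j = 4 then A else if j = 2 then B - 1 else E * F) ?_ 4 (by simp)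
    simpa [add_assoc] using hzero
  have h₁' : t + t⁻¹ ≠ 0 := by
    have : t + t⁻¹ = (t ^ 2 + 1) / t := by field_simp
    rw [this]; exact div_ne_zero h₁ ht0
  have h₂' : r * t + (r * t)⁻¹ ≠ 0 := by
    have : r * t + (r * t)⁻¹ = (r ^ 2 * t ^ 2 + 1) / (r * t) := by field_simp
    rw [this]; exact div_ne_zero h₂ (mul_ne_zero hr0 ht0)
  exact mul_ne_zero (mul_ne_zero (inv_ne_zero h₁') (mul_ne_zero hr0 ht0)) (inv_ne_zero h₂') hA0

/-- The algebra generated by `(x, Λx⁻¹)` and `(y, -y⁻¹)` projects injectively to both sides: it is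
the graph of the involution `x ↦ Λx⁻¹`, `y ↦ -y⁻¹` on the quantum plane. -/
theorem fst_eq_zero_iff_snd_eq_zero (hD : IsQDivisionRing k D q x y) (hq : q ≠ 0) {z : D × D}
    (hz : z ∈ Algebra.adjoin k
      {(x, (y⁻¹ - (algebraMap k D q)⁻¹ * y) * x⁻¹), (y, -y⁻¹)}) : z.1 = 0 ↔ z.2 = 0 := by
  obtain ⟨ι, hι⟩ := exists_fractionRing_hom hD.transcendental
  set t : FractionRing k[X] := algebraMap k[X] _ X with ht
  set r : FractionRing k[X] := algebraMap k[X] _ (C q) with hr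
  have hιt : ι t = y := by rw [hι, aeval_X]
  have hιr : ι r = algebraMap k D q := by rw [hι, aeval_C]
  have hr0 : r ≠ 0 := by simpa [hr] using hq
  have ht0 : t ≠ 0 := by simp [ht]
  have hf : t⁻¹ - r⁻¹ * t ≠ 0 := by
    have h1 : t⁻¹ - r⁻¹ * t = (r - t ^ 2) / (r * t) := by field_simp
    have h2 : C q - X ^ 2 ≠ 0 := fun h => hq (by simpa using congrArg (eval 0) h)
    have h3 := (map_ne_zero_iff _ (IsFractionRing.injective k[X] (FractionRing k[X]))).2 h2
    rw [map_sub, map_pow] at h3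
    rw [h1]
    exact div_ne_zero h3 (mul_ne_zero hr0 ht0)
  have htr : Transcendental k t :=
    (transcendental_algebraMap_iff (IsFractionRing.injective k[X] _)).2 (transcendental_X k)
  have hv : Transcendental k (-t⁻¹) := fun h =>
    htr (IsAlgebraic.inv_iff.1 (by simpa using h.neg))
  have hli := linearIndependent_monomials_inv hD.monomials_linearIndependent hD.x_ne_zero hι
    (exists_semiconjBy_of_semiconjBy (hD.semiconjBy_inv hq) hι) hv hf
  simp only [map_neg, map_inv₀, map_sub, map_mul, hιt, hιr] at hli
  refine fst_eq_zero_iff_snd_eq_zero_of_mem_adjoin (q := q) ?_ ?_ hD.monomials_linearIndependent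
    hli hz
  · rw [hD.rel, Algebra.smul_def]
  · have h1 := (hD.semiconjBy_inv hq).inv_right₀.eq
    have h2 : (q⁻¹ • y)⁻¹ = q • y⁻¹ := by
      rw [Algebra.smul_def, Algebra.smul_def, mul_inv_rev, map_inv₀, inv_inv, Algebra.commutes]
    rw [h2] at h1
    have hc : Commute (y⁻¹ - (algebraMap k D q)⁻¹ * y) y⁻¹ := by
      rw [← map_inv₀]
      exact (Commute.refl _).sub_left
        (Commute.mul_left (Algebra.commutes _ _) (Commute.refl y).inv_right₀)
    rw [mul_neg, mul_assoc, h1, smul_mul_assoc, mul_smul_comm, ← mul_assoc, hc.eq, neg_mul,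
      smul_neg, mul_assoc]

/-- The automorphism `x ↦ Λx⁻¹`, `y ↦ -y⁻¹` of `D` fixes `h` and `g`, but sends `b` to `-b`. -/
theorem not_memDivisionClosure_add_inv [CharZero k] (hD : IsQDivisionRing k D q x y) (hq : q ≠ 0) :
    let Λ : D := y⁻¹ - (algebraMap k D q)⁻¹ * y
    let h : D := (y + y⁻¹)⁻¹ * (x - Λ * x⁻¹)
    let g : D := (y + y⁻¹)⁻¹ * (x * y + Λ * (x⁻¹ * y⁻¹))
    ¬ MemDivisionClosure k {h, g} (y + y⁻¹) := by
  intro Λ h g hb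
  set Q := algebraMap k D q
  set B := Algebra.adjoin k {(x, Λ * x⁻¹), (y, -y⁻¹)} with hB
  have h0 : ∀ p ∈ B, p.1 = 0 ↔ p.2 = 0 := fun p hp => hD.fst_eq_zero_iff_snd_eq_zero hq hp
  have hlift (d : D) (hd : d ∈ Algebra.adjoin k {x, y}) : ∃ p ∈ B, p.1 = d := by
    have : B.map (AlgHom.fst k D D) = Algebra.adjoin k {x, y} := by
      rw [hB, AlgHom.map_adjoin, Set.image_pair]
      rfl
    rw [← this] at hd
    exact hd
  have hfrac (d : D) : ∃ S ∈ B, ∃ T ∈ B, T.1 ≠ 0 ∧ T.1 * d = S.1 := by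
    obtain ⟨s, t, hs, ht, ht0, rfl⟩ := hD.exists_frac d
    obtain ⟨S, hS, rfl⟩ := hlift s hs
    obtain ⟨T, hT, rfl⟩ := hlift t ht
    exact ⟨S, hS, T, hT, ht0, mul_inv_cancel_left₀ ht0 _⟩
  have hQ : FractionGraph B Q⁻¹ Q⁻¹ := (FractionGraph.of_mem (B.algebraMap_mem q)).inv h0
  have hx : FractionGraph B x (Λ * x⁻¹) :=
    FractionGraph.of_mem (Algebra.subset_adjoin (by simp) : (x, Λ * x⁻¹) ∈ B)
  have hy : FractionGraph B y (-y⁻¹) :=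
    FractionGraph.of_mem (Algebra.subset_adjoin (by simp) : (y, -y⁻¹) ∈ B)
  have hyi : FractionGraph B y⁻¹ (-y) := by simpa using hy.inv h0
  have hΛ0 : Λ ≠ 0 := fun hΛ => hD.x_ne_zero
    ((h0 _ (Algebra.subset_adjoin (by simp) : (x, Λ * x⁻¹) ∈ B)).2 (by simp [hΛ]))
  have hΛ : FractionGraph B Λ (-y + Q⁻¹ * y⁻¹) := by
    simpa [Λ, sub_eq_add_neg] using hyi.add h0 hfrac (hQ.mul h0 hfrac hy).neg
  have hxΛ : (-y + Q⁻¹ * y⁻¹) * x = x * Λ := by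
    have h1 : SemiconjBy x y (Q * y) := by
      rw [SemiconjBy, hD.rel, mul_assoc]
    have h2 : x * Q⁻¹ = Q⁻¹ * x := by
      rw [← map_inv₀]; exact (Algebra.commutes _ _).symm
    have hQ0 : Q ≠ 0 := by simpa [Q] using hq
    have hyQ : y⁻¹ * Q⁻¹ = Q⁻¹ * y⁻¹ := by
      rw [← map_inv₀]; exact (Algebra.commutes _ _).symm
    have h3 := h1.inv_right₀.eq
    rw [mul_sub, h3, ← mul_assoc, h2, mul_assoc, h1.eq, mul_inv_rev, hyQ, mul_assoc Q,
      inv_mul_cancel_left₀ hQ0, ← sub_mul, neg_add_eq_sub]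
  have hΛx : FractionGraph B (Λ * x⁻¹) x := by
    have := hΛ.mul h0 hfrac (hx.inv h0)
    rwa [mul_inv_rev, inv_inv, ← mul_assoc, hxΛ, mul_inv_cancel_right₀ hΛ0] at this
  have hbb : FractionGraph B (y + y⁻¹) (-(y + y⁻¹)) := by
    simpa [add_comm] using hy.add h0 hfrac hyi
  have hhh : FractionGraph B h h := by
    have := (hbb.inv h0).mul h0 hfrac (hx.add h0 hfrac hΛx.neg)
    rwa [inv_neg, neg_mul_comm, neg_add_rev, neg_neg, ← sub_eq_add_neg] at this
  have hgg : FractionGraph B g g := by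
    have := (hbb.inv h0).mul h0 hfrac
      ((hx.mul h0 hfrac hy).add h0 hfrac (hΛx.mul h0 hfrac hyi))
    have hc : Λ * x⁻¹ * -y⁻¹ + x * -y = -(x * y + Λ * x⁻¹ * y⁻¹) := by
      rw [mul_neg, mul_neg, neg_add_rev]
    rwa [inv_neg, hc, neg_mul_neg, mul_assoc Λ] at this
  have hb' := FractionGraph.of_memDivisionClosure h0 hfrac
    (by rintro _ (rfl | rfl) <;> assumption) hb
  have := hb'.add h0 hfrac hbb.neg
  rw [add_neg_cancel, neg_neg, ← two_mul] at this
  have hzero := FractionGraph.eq_zero h0 this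
  have : CharZero D := charZero_of_injective_algebraMap (algebraMap k D).injective
  rw [mul_eq_zero, or_iff_right two_ne_zero] at hzero
  have hpoly : (X ^ 2 + 1 : k[X]) = 0 := by
    refine transcendental_iff.1 hD.transcendental _ ?_
    rw [map_add, map_pow, aeval_X, map_one, pow_two, ← mul_inv_cancel₀ hD.y_ne_zero, ← mul_add,
      hzero, mul_zero]
  simpa using congrArg (eval 0) hpoly

end IsQDivisionRing

/-- `b² = (y+y⁻¹)²` lies in `R` (indeed `b² = (y − y⁻¹)² + 4`), `b` itself does not lie in
`R`, and the division subring of `D` generated by `R` together with `b` (equivalently,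
generated over `k` by `h`, `g` and `b`) is all of `D`. -/
theorem stmt3 (k : Type*) [Field k] [CharZero k] (q : k) (hq : q ≠ 0)
    (D : Type*) [DivisionRing D] [Algebra k D] (x y : D)
    (hD : IsQDivisionRing k D q x y) :
    let Q : D := algebraMap k D q
    let Λ : D := y⁻¹ - Q⁻¹ * y
    let a : D := x - Λ * x⁻¹
    let b : D := y + y⁻¹
    let c : D := x * y + Λ * (x⁻¹ * y⁻¹)
    let h : D := b⁻¹ * a
    let g : D := b⁻¹ * c
    b ^ 2 = (y - y⁻¹) ^ 2 + 4 ∧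
    MemDivisionClosure k ({h, g} : Set D) (b ^ 2) ∧
    ¬ MemDivisionClosure k ({h, g} : Set D) b ∧
    ∀ d : D, MemDivisionClosure k ({h, g, b} : Set D) d := by
  intro Q Λ a b c h g
  have hy0 := hD.y_ne_zero
  have hb2 : b ^ 2 = (y - y⁻¹) ^ 2 + 4 := by
    calc b ^ 2 = (y - y⁻¹) ^ 2 + 2 * (y * y⁻¹ + y⁻¹ * y) := by simp only [b]; noncomm_ring
      _ = _ := by rw [mul_inv_cancel₀ hy0, inv_mul_cancel₀ hy0]; norm_num
  have hnb : ¬ MemDivisionClosure k {h, g} b := hD.not_memDivisionClosure_add_inv hq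
  have hb0 : b ≠ 0 := fun hb => hnb (by
    simpa [hb] using MemDivisionClosure.natCast (k := k) (s := {h, g}) 0)
  obtain ⟨hgh, hs⟩ := hD.sub_inv_mul_one_sub_eq hq
  have hh : MemDivisionClosure k {h, g} h := .mem (by simp)
  have hg : MemDivisionClosure k {h, g} g := .mem (by simp)
  have hQ {s : Set D} : MemDivisionClosure k s Q := .scalar q
  have hs' : MemDivisionClosure k {h, g} (y - y⁻¹) := by
    rw [← eq_mul_inv_iff_mul_eq₀ hgh, pow_two, pow_two, pow_two] at hs
    rw [hs]
    exact ((hQ.mul (hh.mul hh)).sub ((hQ.inv.mul hQ.inv).mul (hg.mul hg))).mul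
      (.inv (.sub
        (by simpa using MemDivisionClosure.natCast (s := {h, g}) 1) (hg.mul hh)))
  refine ⟨hb2, ?_, hnb, ?_⟩
  · rw [hb2, pow_two]
    exact (hs'.mul hs').add (by simpa using .natCast 4)
  · have hsub : ({h, g} : Set D) ⊆ {h, g, b} := by
      rintro _ (rfl | rfl) <;> simp
    have hb : MemDivisionClosure k {h, g, b} b := .mem (by simp)
    have : CharZero D := charZero_of_injective_algebraMap (algebraMap k D).injective
    have hy : MemDivisionClosure k {h, g, b} y := by
      have h2 : y = 2⁻¹ * (b + (y - y⁻¹)) := by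
        rw [show b + (y - y⁻¹) = 2 * y by simp only [b]; rw [two_mul]; abel,
          inv_mul_cancel_left₀ two_ne_zero]
      rw [h2]
      exact MemDivisionClosure.mul
        (.inv (by simpa using .natCast 2))
        (hb.add (hs'.mono hsub))
    have ha : MemDivisionClosure k {h, g, b} a := by
      rw [← mul_inv_cancel_left₀ hb0 a]
      exact hb.mul (hh.mono hsub)
    have hc : MemDivisionClosure k {h, g, b} c := by
      rw [← mul_inv_cancel_left₀ hb0 c]
      exact hb.mul (hg.mono hsub)
    have hx : MemDivisionClosure k {h, g, b} x := by
      have h1 : x * b = c + a * y⁻¹ := by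
        simp only [a, b, c, mul_add, sub_mul, mul_assoc]
        abel
      rw [← mul_inv_cancel_right₀ hb0 x, h1]
      exact (hc.add (ha.mul hy.inv)).mul hb.inv
    exact hD.memDivisionClosure hx hy
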